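/- Let 1 < α < 2, γ ∈ ℝ, T > 0, and let λ : ℕ → ℝ be a nondecreasing sequence of positive numbers with λ_n → ∞ such that E_{α,2}(−λ_n T^α) ≠ 0 for every n. Then there exists a constant C_T > 0 (depending on α, γ, T and the sequence λ) such that for every sequence a : ℕ → ℝ, if b_n := T · E_{α,2}(−λ_n T^α) · a_n and the series ∑_{n} λ_n^{2−2γ} b_n² converges, then the series ∑_{n} λ_n^{−2γ} a_n² converges and ∑_{n} λ_n^{−2γ} a_n² ≤ C_T · ∑_{n} λ_n^{2−2γ} b_n². -/

import Mathlib

/-- The two-parameter Mittag-Leffler function `E_{α,β}(t) = ∑_{k=0}^∞ t^k / Γ(α k + β)`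
on the real line, with `Γ` the real Gamma function. -/
noncomputable def mittagLeffler (α β t : ℝ) : ℝ :=
  ∑' k : ℕ, t ^ k / Real.Gamma (α * k + β)

section MLHelpers

open Complex MeasureTheory Set Filter Topology

lemma ml_laplace_int (z : ℝ) (hz : 0 < z) (s : ℝ) (hs : 0 < s) :
    IntegrableOn (fun t : ℝ => t ^ (z - 1) * Real.exp (-(s * t))) (Ioi 0) := by
  have := integrableOn_rpow_mul_exp_neg_mul_rpow (p := 1) (s := z - 1) (b := s) (by linarith)
    one_pos hs
  simpa using this

lemma ml_laplace_aesm (z : ℝ) (s : ℂ) : AEStronglyMeasurable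
    (fun t : ℝ => ((t ^ (z - 1) : ℝ) : ℂ) * cexp (-(s * t))) (volume.restrict (Ioi 0)) := by
  refine Measurable.aestronglyMeasurable ?_
  fun_prop

lemma ml_laplace_intC (z : ℝ) (hz : 0 < z) (s : ℂ) (hs : 0 < s.re) :
    IntegrableOn (fun t : ℝ => ((t ^ (z - 1) : ℝ) : ℂ) * cexp (-(s * t))) (Ioi 0) := by
  refine Integrable.mono' (ml_laplace_int z hz s.re hs) (ml_laplace_aesm z s) ?_
  filter_upwards [ae_restrict_mem measurableSet_Ioi] with t ht
  have ht : 0 < t := ht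
  rw [norm_mul, Complex.norm_exp, Complex.norm_real, Real.norm_of_nonneg (by positivity)]
  simp

lemma ml_laplace_deriv (z : ℝ) (hz : 0 < z) (s : ℂ) (hs : 0 < s.re) :
    DifferentiableAt ℂ
      (fun s : ℂ => ∫ t in Ioi (0 : ℝ), ((t ^ (z - 1) : ℝ) : ℂ) * cexp (-(s * t))) s := by
  have h := hasDerivAt_integral_of_dominated_loc_of_deriv_le (μ := volume.restrict (Ioi (0 : ℝ)))
    (F := fun s t => ((t ^ (z - 1) : ℝ) : ℂ) * cexp (-(s * t)))
    (F' := fun s t => ((t ^ (z - 1) : ℝ) : ℂ) * (cexp (-(s * t)) * (-(t : ℂ))))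
    (x₀ := s) (s := {w : ℂ | s.re / 2 < w.re})
    (bound := fun t => t ^ (z + 1 - 1) * Real.exp (-(s.re / 2 * t)))
    ((isOpen_lt continuous_const continuous_re).mem_nhds (by simp; linarith))
    (Eventually.of_forall fun w => ml_laplace_aesm z w)
    (ml_laplace_intC z hz s hs) (Measurable.aestronglyMeasurable (by fun_prop)) ?_
    (ml_laplace_int (z + 1) (by linarith) (s.re / 2) (by linarith)) ?_
  · exact h.2.differentiableAt
  · filter_upwards [ae_restrict_mem measurableSet_Ioi] with t ht w hw
    have ht : 0 < t := ht
    have hw : s.re / 2 < w.re := hw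
    rw [norm_mul, norm_mul, Complex.norm_exp, Complex.norm_real, Real.norm_of_nonneg (by positivity),
      norm_neg, Complex.norm_real, Real.norm_of_nonneg ht.le]
    have : t ^ (z + 1 - 1) = t ^ (z - 1) * t := by
      rw [← Real.rpow_add_one ht.ne']; ring_nf
    rw [this]
    have h2 : Real.exp (-(w * t)).re ≤ Real.exp (-(s.re / 2 * t)) := by
      apply Real.exp_le_exp.2
      simp
      nlinarith
    have : 0 < t ^ (z - 1) := by positivity
    calc _ = t ^ (z - 1) * t * Real.exp (-(w * t)).re := by ring
      _ ≤ _ := by gcongr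
  · filter_upwards with t w hw
    have : HasDerivAt (fun w : ℂ => -(w * t)) (-(t : ℂ)) w := by
      have h := ((hasDerivAt_id w).mul_const (t : ℂ)).neg
      rw [one_mul] at h
      exact h
    exact (this.cexp).const_mul _

lemma ml_laplace (z : ℝ) (hz : 0 < z) (s : ℂ) (hs : 0 < s.re) :
    ∫ t in Ioi (0 : ℝ), ((t ^ (z - 1) : ℝ) : ℂ) * cexp (-(s * t))
      = s ^ (-(z : ℂ)) * (Real.Gamma z : ℂ) := by
  have hU : IsOpen {w : ℂ | 0 < w.re} := isOpen_lt continuous_const continuous_re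
  have hA : AnalyticOnNhd ℂ
      (fun s : ℂ => ∫ t in Ioi (0 : ℝ), ((t ^ (z - 1) : ℝ) : ℂ) * cexp (-(s * t)))
      {w : ℂ | 0 < w.re} :=
    DifferentiableOn.analyticOnNhd
      (fun w hw => (ml_laplace_deriv z hz w hw).differentiableWithinAt) hU
  have hB : AnalyticOnNhd ℂ (fun s : ℂ => s ^ (-(z : ℂ)) * (Real.Gamma z : ℂ))
      {w : ℂ | 0 < w.re} := by
    refine DifferentiableOn.analyticOnNhd (fun w hw => ?_) hU
    refine DifferentiableAt.differentiableWithinAt ?_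
    exact (DifferentiableAt.cpow_const (f := fun s : ℂ => s) differentiableAt_id
      (Or.inl hw)).mul_const _
  have hreal : ∀ r : ℝ, 0 < r → ∫ t in Ioi (0 : ℝ), ((t ^ (z - 1) : ℝ) : ℂ) * cexp (-(r * t))
      = (r : ℂ) ^ (-(z : ℂ)) * (Real.Gamma z : ℂ) := by
    intro r hr
    have h := Real.integral_rpow_mul_exp_neg_mul_Ioi hz hr
    have h2 := congrArg (fun x : ℝ => (x : ℂ)) h
    rw [← integral_complex_ofReal] at h2
    push_cast at h2 ⊢
    rw [h2, ← Complex.Gamma_ofReal]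
    congr 1
    rw [Complex.ofReal_cpow (by positivity), one_div, Complex.cpow_neg]
    push_cast
    rw [Complex.inv_cpow]
    rw [Complex.arg_ofReal_of_nonneg hr.le]
    exact Real.pi_pos.ne
  refine hA.eqOn_of_preconnected_of_frequently_eq hB
    (convex_halfSpace_re_gt 0).isPreconnected (z₀ := 1) (by simp) ?_ hs
  have ht : Tendsto (fun n : ℕ => ((1 + 1 / ((n : ℝ) + 1) : ℝ) : ℂ)) atTop (𝓝[≠] 1) := by
    refine tendsto_nhdsWithin_iff.2 ⟨?_, Eventually.of_forall fun n => ?_⟩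
    · have := (tendsto_one_div_add_atTop_nhds_zero_nat (𝕜 := ℝ)).const_add 1
      have h3 := (Complex.continuous_ofReal.tendsto _).comp this
      simpa [Function.comp_def] using h3
    · have : (0 : ℝ) < 1 / ((n : ℝ) + 1) := by positivity
      intro h
      have h : ((1 + 1 / ((n : ℝ) + 1) : ℝ) : ℂ) = ((1 : ℝ) : ℂ) := by simpa using h
      rw [Complex.ofReal_inj] at h
      linarith
  refine ht.frequently (Eventually.frequently (Eventually.of_forall fun n => ?_))
  exact hreal _ (by positivity)

lemma ml_norm_line (c y : ℝ) : ‖(c : ℂ) + y * I‖ = Real.sqrt (c ^ 2 + y ^ 2) :=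
  Complex.norm_add_mul_I c y

lemma ml_line_int (p : ℝ) (hp : 1 < p) :
    Integrable (fun y : ℝ => (1 + y ^ 2) ^ (-p / 2)) := by
  have := integrable_rpow_neg_one_add_norm_sq (E := ℝ) (μ := volume) (r := p) (by simpa using hp)
  simpa using this

lemma ml_line_bound (p : ℝ) (hp : 0 < p) (c : ℝ) (hc : 1 ≤ c) (y : ℝ) :
    ‖(c : ℂ) + y * I‖ ^ (-p) ≤ (1 + y ^ 2) ^ (-p / 2) := by
  rw [ml_norm_line, Real.sqrt_eq_rpow, ← Real.rpow_mul (by positivity)]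
  have : (1 / 2 : ℝ) * -p = -p / 2 := by ring
  rw [this]
  exact Real.rpow_le_rpow_of_nonpos (by positivity) (by nlinarith) (by linarith)

lemma ml_line_intC (z : ℝ) (hz : 1 < z) (c : ℝ) (hc : 1 ≤ c) :
    Integrable (fun y : ℝ => ((c : ℂ) + y * I) ^ (-(z : ℂ))) := by
  refine (ml_line_int z hz).mono' (Measurable.aestronglyMeasurable (by fun_prop)) ?_
  filter_upwards with y
  have : (-(z : ℂ)) = ((-z : ℝ) : ℂ) := by push_cast; rfl
  rw [this, Complex.norm_cpow_real]
  exact ml_line_bound z (by linarith) c hc y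

lemma ml_line_exp_intC (z : ℝ) (hz : 1 < z) (c : ℝ) (hc : 1 ≤ c) :
    Integrable (fun y : ℝ => cexp ((c : ℂ) + y * I) * ((c : ℂ) + y * I) ^ (-(z : ℂ))) := by
  refine (ml_line_intC z hz c hc).bdd_mul (c := Real.exp c)
    (Measurable.aestronglyMeasurable (by fun_prop)) ?_
  filter_upwards with y
  rw [Complex.norm_exp]; simp

lemma ml_hankel (z : ℝ) (hz : 1 < z) (c : ℝ) (hc : 1 ≤ c) :
    ∫ y : ℝ, cexp ((c : ℂ) + y * I) * ((c : ℂ) + y * I) ^ (-(z : ℂ))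
      = ((2 * Real.pi / Real.Gamma z : ℝ) : ℂ) := by
  set φ : ℝ → ℂ := (Ioi (0 : ℝ)).indicator
    (fun t : ℝ => ((t ^ (z - 1) : ℝ) : ℂ) * cexp (-((c : ℂ) * t))) with hφ
  have hφi : Integrable φ :=
    (integrable_indicator_iff measurableSet_Ioi).2 (ml_laplace_intC z (by linarith) c (by simp; linarith))
  have hF : ∀ ξ : ℝ, FourierTransform.fourier φ ξ
      = ((c : ℂ) + ((2 * Real.pi * ξ : ℝ) : ℂ) * I) ^ (-(z : ℂ)) * (Real.Gamma z : ℂ) := by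
    intro ξ
    rw [Real.fourier_real_eq_integral_exp_smul, ← ml_laplace z (by linarith) _ (by simp; linarith),
      ← integral_indicator measurableSet_Ioi]
    congr 1
    ext t
    by_cases ht : t ∈ Ioi (0 : ℝ)
    · simp only [hφ, indicator_of_mem ht, smul_eq_mul]
      rw [mul_left_comm, ← Complex.exp_add]
      congr 2
      push_cast
      ring
    · simp only [hφ, indicator_of_notMem ht, smul_zero]
  have hFi : Integrable (FourierTransform.fourier φ) := by
    have : FourierTransform.fourier φ = fun ξ : ℝ =>
      ((c : ℂ) + ((2 * Real.pi * ξ : ℝ) : ℂ) * I) ^ (-(z : ℂ)) * (Real.Gamma z : ℂ) := funext hF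
    rw [this]
    exact ((ml_line_intC z hz c hc).comp_mul_left' (R := 2 * Real.pi) (by positivity)).mul_const _
  have hcont : ContinuousAt φ 1 := by
    have h1 : ContinuousAt (fun t : ℝ => ((t ^ (z - 1) : ℝ) : ℂ) * cexp (-((c : ℂ) * t))) 1 := by
      refine ContinuousAt.mul (Complex.continuous_ofReal.continuousAt.comp
        (Real.continuousAt_rpow_const _ _ (Or.inl one_ne_zero))) (by fun_prop)
    refine h1.congr ?_
    filter_upwards [Ioi_mem_nhds (zero_lt_one' ℝ)] with t ht
    rw [hφ, indicator_of_mem ht]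
  have hinv := hφi.fourierInv_fourier_eq hFi hcont
  rw [Real.fourierInv_eq'] at hinv
  have h1 : φ 1 = cexp (-c) := by
    rw [hφ, indicator_of_mem (by simp)]; simp
  rw [h1] at hinv
  have h2 := Measure.integral_comp_mul_left
    (fun y : ℝ => cexp ((c : ℂ) + y * I) * ((c : ℂ) + y * I) ^ (-(z : ℂ))) (2 * Real.pi)
  have hG : Real.Gamma z ≠ 0 := (Real.Gamma_pos_of_pos (by linarith)).ne'
  have h3 : (∫ v : ℝ, cexp (((2 * Real.pi * inner ℝ v 1 : ℝ) : ℂ) * I) • FourierTransform.fourier φ v)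
     = (cexp (-c) * (Real.Gamma z : ℂ)) * ∫ x : ℝ, cexp ((c : ℂ) + ((2 * Real.pi * x : ℝ) : ℂ) * I) *
        ((c : ℂ) + ((2 * Real.pi * x : ℝ) : ℂ) * I) ^ (-(z : ℂ)) := by
    rw [← integral_const_mul]
    congr 1
    ext v
    rw [hF, Complex.exp_add, Complex.exp_neg]
    have : inner ℝ v (1 : ℝ) = v := by simp
    rw [this, smul_eq_mul]
    field_simp [Complex.exp_ne_zero]
  rw [h3, h2] at hinv
  rw [abs_of_pos (by positivity)] at hinv
  have he := Complex.exp_ne_zero (-c : ℂ)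
  have hGC : (Real.Gamma z : ℂ) ≠ 0 := by exact_mod_cast hG
  rw [mul_assoc, Complex.real_smul] at hinv
  have hinv := mul_left_cancel₀ he (hinv.trans (mul_one _).symm)
  have hpi : (Real.pi : ℂ) ≠ 0 := by exact_mod_cast Real.pi_pos.ne'
  generalize (∫ y : ℝ, cexp ((c : ℂ) + y * I) * ((c : ℂ) + y * I) ^ (-(z : ℂ))) = J at hinv ⊢
  push_cast at hinv ⊢
  field_simp at hinv ⊢
  linear_combination hinv

lemma ml_line_f_int (f : ℂ → ℂ) (c M p : ℝ) (hp : 1 < p) (hM0 : 0 ≤ M) (hc : 1 ≤ c)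
    (hf : ∀ s : ℂ, 1 ≤ s.re → DifferentiableAt ℂ f s)
    (hM : ∀ s : ℂ, s.re = c → ‖f s‖ ≤ M * ‖s‖ ^ (-p)) :
    Integrable (fun y : ℝ => f ((c : ℂ) + y * I)) := by
  refine ((ml_line_int p hp).const_mul M).mono' (Continuous.aestronglyMeasurable ?_) ?_
  · refine continuous_iff_continuousAt.2 fun y => ?_
    have h1 : ContinuousAt f ((c : ℂ) + y * I) := (hf _ (by simpa using hc)).continuousAt
    exact ContinuousAt.comp (f := fun y : ℝ => (c : ℂ) + y * I) h1 (by fun_prop)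
  · filter_upwards with y
    refine (hM _ (by simp)).trans ?_
    gcongr
    exact ml_line_bound p (by linarith) c hc y

lemma ml_shift (f : ℂ → ℂ) (c M p : ℝ) (hp : 1 < p) (hM0 : 0 ≤ M) (hc : 1 ≤ c)
    (hf : ∀ s : ℂ, 1 ≤ s.re → DifferentiableAt ℂ f s)
    (hM : ∀ s : ℂ, 1 ≤ s.re → s.re ≤ c → ‖f s‖ ≤ M * ‖s‖ ^ (-p)) :
    ∫ y : ℝ, f ((1 : ℝ) + y * I) = ∫ y : ℝ, f ((c : ℂ) + y * I) := by
  have i1 := ml_line_f_int f 1 M p hp hM0 le_rfl hf (fun s hs => hM s hs.ge (hs.le.trans hc))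
  have i2 := ml_line_f_int f c M p hp hM0 hc hf (fun s hs => hM s (hc.trans hs.ge) hs.le)
  have t0 : Tendsto (fun n : ℝ => n) atTop atTop := tendsto_id
  have t1 := intervalIntegral_tendsto_integral i1 tendsto_neg_atTop_atBot t0
  have t2 := intervalIntegral_tendsto_integral i2 tendsto_neg_atTop_atBot t0
  have hor : ∀ n : ℝ, 0 < n → ∀ m : ℝ, |m| = n →
      ‖∫ x : ℝ in (1 : ℝ)..c, f (x + m * I)‖ ≤ M * n ^ (-p) * |c - 1| := by
    intro n hn m hm
    refine intervalIntegral.norm_integral_le_of_norm_le_const fun x hx => ?_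
    rw [uIoc_of_le hc] at hx
    refine (hM _ (by simpa using hx.1.le) (by simpa using hx.2)).trans ?_
    refine mul_le_mul_of_nonneg_left ?_ hM0
    refine Real.rpow_le_rpow_of_nonpos hn ?_ (by linarith)
    have := Complex.abs_im_le_norm ((x : ℂ) + m * I)
    simp at this
    rw [← hm]; exact this
  have key : ∀ n : ℝ, 0 < n →
      ‖(∫ y : ℝ in (-n)..n, f ((c : ℂ) + y * I)) - ∫ y : ℝ in (-n)..n, f ((1 : ℝ) + y * I)‖
        ≤ 2 * (M * n ^ (-p) * |c - 1|) := by
    intro n hn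
    have h := Complex.integral_boundary_rect_eq_zero_of_differentiableOn f
      (((1 : ℝ) : ℂ) + ((-n : ℝ) : ℂ) * I) ((c : ℂ) + (n : ℂ) * I) ?_
    · have e1 : ((((1 : ℝ) : ℂ) + ((-n : ℝ) : ℂ) * I)).re = 1 := by simp
      have e2 : ((((1 : ℝ) : ℂ) + ((-n : ℝ) : ℂ) * I)).im = -n := by simp
      have e3 : ((c : ℂ) + (n : ℂ) * I).re = c := by simp
      have e4 : ((c : ℂ) + (n : ℂ) * I).im = n := by simp
      rw [e1, e2, e3, e4] at h
      have ha := hor n hn (-n) (by rw [abs_neg, abs_of_pos hn])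
      have hb := hor n hn n (abs_of_pos hn)
      generalize (∫ x : ℝ in (1 : ℝ)..c, f (x + ((-n : ℝ) : ℂ) * I)) = A at h ha
      generalize (∫ x : ℝ in (1 : ℝ)..c, f (x + (n : ℂ) * I)) = B at h hb
      generalize (∫ y : ℝ in (-n)..n, f ((c : ℂ) + y * I)) = D at h ⊢
      generalize (∫ y : ℝ in (-n)..n, f (((1 : ℝ) : ℂ) + y * I)) = E at h ⊢
      have : D - E = I * (A - B) := by
        simp only [smul_eq_mul] at h
        linear_combination (-I) * h + (D - E) * Complex.I_sq
      rw [this, norm_mul, Complex.norm_I, one_mul]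
      linarith [norm_sub_le A B]
    · intro s hs
      have := hs.1
      simp [uIcc_of_le hc] at this
      exact (hf s this.1).differentiableWithinAt
  have t3 : Tendsto (fun n : ℝ => 2 * (M * n ^ (-p) * |c - 1|)) atTop (𝓝 0) := by
    have := tendsto_rpow_neg_atTop (y := p) (by linarith)
    simpa using ((this.const_mul M).mul_const |c - 1|).const_mul 2
  have t4 : Tendsto (fun n : ℝ => (∫ y : ℝ in (-n)..n, f ((c : ℂ) + y * I))
      - ∫ y : ℝ in (-n)..n, f ((1 : ℝ) + y * I)) atTop (𝓝 0) := by
    refine squeeze_zero_norm' ?_ t3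
    filter_upwards [eventually_gt_atTop 0] with n hn using key n hn
  have := tendsto_nhds_unique t4 (t2.sub t1)
  exact (sub_eq_zero.1 this.symm).symm

noncomputable def mlW (α x : ℝ) (s : ℂ) : ℂ := s ^ (α : ℂ) / x

noncomputable def mlS (α x : ℝ) (s : ℂ) : ℂ :=
  (mlW α x s) ^ 2 * ((α - 2) * mlW α x s + (2 * α - 2)) / ((mlW α x s + 1) ^ 2 * s ^ 3)

lemma ml_kappa (α : ℝ) (hα1 : 1 < α) (hα2 : α < 2) :
    Real.cos (α * (Real.pi / 2)) < 0 ∧ 0 < 1 + Real.cos (α * (Real.pi / 2)) := by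
  have hpi := Real.pi_pos
  constructor
  · apply Real.cos_neg_of_pi_div_two_lt_of_lt <;> nlinarith
  · have := Real.cos_lt_cos_of_nonneg_of_le_pi (x := α * (Real.pi / 2)) (y := Real.pi)
      (by positivity) le_rfl (by nlinarith)
    rw [Real.cos_pi] at this
    linarith

lemma ml_W_norm (α x : ℝ) (hx : 0 < x) (s : ℂ) : ‖mlW α x s‖ = ‖s‖ ^ α / x := by
  rw [mlW, norm_div, Complex.norm_cpow_real, Complex.norm_real, Real.norm_of_nonneg hx.le]

lemma ml_W_lower (α x : ℝ) (hα1 : 1 < α) (hα2 : α < 2) (hx : 0 < x) (s : ℂ) (hs : 0 < s.re) :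
    (1 + Real.cos (α * (Real.pi / 2))) * (1 + ‖mlW α x s‖ ^ 2) ≤ ‖mlW α x s + 1‖ ^ 2 := by
  obtain ⟨hk, -⟩ := ml_kappa α hα1 hα2
  have hs0 : s ≠ 0 := by rintro rfl; simp at hs
  have hre : Real.cos (α * (Real.pi / 2)) * ‖mlW α x s‖ ≤ (mlW α x s).re := by
    rw [ml_W_norm α x hx, mlW, Complex.div_ofReal_re, Complex.cpow_ofReal_re, mul_div_assoc',
      mul_comm (Real.cos _)]
    gcongr
    rw [← Real.cos_abs (s.arg * α)]
    have := Complex.abs_arg_le_pi_div_two_iff.2 hs.le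
    apply Real.cos_le_cos_of_nonneg_of_le_pi (abs_nonneg _)
    · nlinarith [Real.pi_pos]
    · rw [abs_mul, abs_of_pos (by linarith : 0 < α), mul_comm]
      gcongr
  have e : ‖mlW α x s + 1‖ ^ 2 = ‖mlW α x s‖ ^ 2 + 2 * (mlW α x s).re + 1 := by
    rw [← Complex.normSq_eq_norm_sq, ← Complex.normSq_eq_norm_sq, Complex.normSq_apply,
      Complex.normSq_apply]
    simp
    ring
  rw [e]
  nlinarith [mul_nonneg (neg_nonneg.2 hk.le) (sq_nonneg (‖mlW α x s‖ - 1))]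

lemma ml_W_ne (α x : ℝ) (hα1 : 1 < α) (hα2 : α < 2) (hx : 0 < x) (s : ℂ) (hs : 0 < s.re) :
    mlW α x s + 1 ≠ 0 := by
  intro h
  have := ml_W_lower α x hα1 hα2 hx s hs
  rw [h] at this
  have h2 := (ml_kappa α hα1 hα2).2
  have : 0 < (1 + Real.cos (α * (Real.pi / 2))) * (1 + ‖mlW α x s‖ ^ 2) := by positivity
  simp at *
  linarith

lemma ml_S_diff (α x : ℝ) (hα1 : 1 < α) (hα2 : α < 2) (hx : 0 < x) (s : ℂ) (hs : 0 < s.re) :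
    DifferentiableAt ℂ (mlS α x) s := by
  have hs0 : s ≠ 0 := by rintro rfl; simp at hs
  have h1 : DifferentiableAt ℂ (mlW α x) s :=
    (DifferentiableAt.cpow_const (f := fun s : ℂ => s) differentiableAt_id
      (Or.inl hs)).div_const _
  have h2 := ml_W_ne α x hα1 hα2 hx s hs
  unfold mlS
  refine DifferentiableAt.div (by fun_prop) (by fun_prop) ?_
  positivity

lemma ml_real_ineq (W q : ℝ) (hW : 0 < W) (hq1 : 1 ≤ q) (hq2 : q ≤ 2) :
    W ^ 2 * (1 + W) ≤ 2 * W ^ q * (1 + W ^ 2) := by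
  rcases le_total W 1 with h | h
  · have h1 : W ^ (2 : ℝ) ≤ W ^ q := Real.rpow_le_rpow_of_exponent_ge hW h hq2
    rw [Real.rpow_two] at h1
    have : 0 ≤ W ^ q := by positivity
    nlinarith [mul_le_mul h1 (by nlinarith : 1 + W ≤ 2 * (1 + W ^ 2)) (by positivity) this]
  · have h1 : W ^ (1 : ℝ) ≤ W ^ q := Real.rpow_le_rpow_of_exponent_le h hq1
    rw [Real.rpow_one] at h1
    have : 0 ≤ W ^ q := by positivity
    nlinarith [mul_le_mul h1 (by nlinarith : W * (1 + W) ≤ 2 * (1 + W ^ 2)) (by positivity) this]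

lemma ml_S_bound (α x : ℝ) (hα1 : 1 < α) (hα2 : α < 2) (hx : 0 < x) (s : ℂ) (hs : 0 < s.re) :
    ‖mlS α x s‖ ≤ 4 / (1 + Real.cos (α * (Real.pi / 2))) * x ^ (-(1 / α + 1 / 2))
      * ‖s‖ ^ (-(2 - α / 2)) := by
  have hs0 : s ≠ 0 := by rintro rfl; simp at hs
  have hr : 0 < ‖s‖ := norm_pos_iff.2 hs0
  have hδ := (ml_kappa α hα1 hα2).2
  set δ := 1 + Real.cos (α * (Real.pi / 2)) with hδd
  have hlow := ml_W_lower α x hα1 hα2 hx s hs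
  rw [← hδd] at hlow
  have hWn := ml_W_norm α x hx s
  have hW : 0 < ‖mlW α x s‖ := by rw [hWn]; positivity
  have hnum : ‖((α : ℂ) - 2) * mlW α x s + (2 * α - 2)‖ ≤ 2 * (1 + ‖mlW α x s‖) := by
    have e1 : ((α : ℂ) - 2) = ((α - 2 : ℝ) : ℂ) := by push_cast; rfl
    have e2 : (2 * (α : ℂ) - 2) = ((2 * α - 2 : ℝ) : ℂ) := by push_cast; rfl
    refine (norm_add_le _ _).trans ?_
    rw [norm_mul, e1, e2, Complex.norm_real, Complex.norm_real, Real.norm_eq_abs, Real.norm_eq_abs,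
      abs_of_neg (by linarith), abs_of_pos (by linarith)]
    nlinarith
  have hq := ml_real_ineq ‖mlW α x s‖ (1 / α + 1 / 2) hW
    (by rw [div_add_div _ _ (by linarith) two_ne_zero, le_div_iff₀ (by linarith)]; linarith)
    (by rw [div_add_div _ _ (by linarith) two_ne_zero, div_le_iff₀ (by linarith)]; linarith)
  have hWq : ‖mlW α x s‖ ^ (1 / α + 1 / 2) / ‖s‖ ^ 3
      = x ^ (-(1 / α + 1 / 2)) * ‖s‖ ^ (-(2 - α / 2)) := by
    rw [hWn, Real.div_rpow (by positivity) hx.le, ← Real.rpow_mul hr.le, Real.rpow_neg hx.le]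
    have e : -(2 - α / 2) = α * (1 / α + 1 / 2) - (3 : ℕ) := by
      field_simp; push_cast; ring
    rw [e, Real.rpow_sub_natCast hr.ne']
    ring
  rw [mlS, norm_div, norm_mul, norm_mul, norm_pow, norm_pow, norm_pow, mul_assoc, ← hWq]
  generalize ‖mlW α x s‖ ^ (1 / α + 1 / 2) = Q at *
  generalize ‖mlW α x s‖ = W at *
  generalize ‖mlW α x s + 1‖ = V at *
  have hV : 0 < V ^ 2 := lt_of_lt_of_le (by positivity) hlow
  rw [mul_div_assoc', div_mul_eq_mul_div, div_div, div_le_div_iff₀ (by positivity) (by positivity)]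
  have h5 : W ^ 2 * ‖((α : ℂ) - 2) * mlW α x s + (2 * α - 2)‖ ≤ 4 * Q * (1 + W ^ 2) := by
    calc _ ≤ W ^ 2 * (2 * (1 + W)) := by gcongr
      _ ≤ _ := by linarith
  have hQ : 0 ≤ Q := by
    by_contra hQ
    push Not at hQ
    nlinarith [mul_pos (neg_pos.2 hQ) (by positivity : 0 < 1 + W ^ 2), 
       (by positivity : 0 < W ^ 2 * (1 + W))]
  calc _ ≤ 4 * Q * (1 + W ^ 2) * (δ * ‖s‖ ^ 3) := by gcongr
    _ = 4 * Q * (δ * (1 + W ^ 2)) * ‖s‖ ^ 3 := by ring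
    _ ≤ 4 * Q * V ^ 2 * ‖s‖ ^ 3 := by gcongr
    _ = _ := by ring

lemma ml_S_series (α x : ℝ) (hx : 0 < x) (s : ℂ)
    (hs : s ≠ 0) (hxs : x < ‖s‖ ^ α) :
    HasSum (fun k : ℕ => (-(x : ℂ)) ^ k * (α * k + 2) * s ^ (-((α * k + 3 : ℝ) : ℂ)))
      (mlS α x s + (2 - α) / x * s ^ (-((3 - α : ℝ) : ℂ))) := by
  have hxC : (x : ℂ) ≠ 0 := by exact_mod_cast hx.ne'
  have hwC : s ^ (α : ℂ) ≠ 0 := by simp [Complex.cpow_eq_zero_iff, hs]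
  set v := s ^ (α : ℂ) with hv
  have hq : ‖-(x : ℂ) / v‖ < 1 := by
    rw [norm_div, norm_neg, hv, Complex.norm_cpow_real, Complex.norm_real,
      Real.norm_of_nonneg hx.le, div_lt_one (hx.trans hxs)]
    exact hxs
  have h1 := ((hasSum_coe_mul_geometric_of_norm_lt_one hq).mul_left (α : ℂ)).add
    ((hasSum_geometric_of_norm_lt_one hq).mul_left 2)
  have h2 := h1.mul_left ((s ^ 3)⁻¹)
  have hv1 : v + x ≠ 0 := by
    intro h
    have : v = -(x : ℂ) := by linear_combination h
    rw [← this, div_self hwC] at hq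
    simp at hq
  have hA : (fun k : ℕ => (-(x : ℂ)) ^ k * (α * k + 2) * s ^ (-((α * k + 3 : ℝ) : ℂ)))
      = fun i : ℕ => (s ^ 3)⁻¹ * (↑α * (↑i * (-↑x / v) ^ i) + 2 * (-↑x / v) ^ i) := by
    ext k
    have : s ^ (-((α * k + 3 : ℝ) : ℂ)) = (v ^ k)⁻¹ * (s ^ 3)⁻¹ := by
      push_cast
      rw [neg_add, Complex.cpow_add _ _ hs, Complex.cpow_neg, Complex.cpow_neg, mul_comm (α : ℂ),
        Complex.cpow_nat_mul]
      norm_cast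
    rw [this, div_pow]
    ring
  have hB : mlS α x s + (2 - ↑α) / ↑x * s ^ (-((3 - α : ℝ) : ℂ))
      = (s ^ 3)⁻¹ * (↑α * (-↑x / v / (1 - -↑x / v) ^ 2) + 2 * (1 - -↑x / v)⁻¹) := by
    have : s ^ (-((3 - α : ℝ) : ℂ)) = v / s ^ 3 := by
      push_cast
      rw [neg_sub, Complex.cpow_sub _ _ hs]
      norm_cast
    rw [this, mlS, mlW, ← hv]
    have e1 : v / x + 1 = (v + x) / x := by field_simp
    have e2 : 1 - -(x : ℂ) / v = (v + x) / v := by field_simp; ring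
    rw [e1, e2]
    field_simp
    ring
  rw [hA, hB]
  exact h2

lemma ml_rep (α x : ℝ) (hα1 : 1 < α) (hα2 : α < 2) (hx : 0 < x) :
    ((2 * Real.pi * (mittagLeffler α 2 (-x) - 1 / (x * Real.Gamma (2 - α))) : ℝ) : ℂ)
      = ∫ y : ℝ, cexp ((1 : ℝ) + y * I) * mlS α x ((1 : ℝ) + y * I) := by
  obtain ⟨c, hc, hcx⟩ : ∃ c : ℝ, 1 ≤ c ∧ x < c ^ α := by
    refine ⟨(2 * x) ^ (1 / α) + 1, by have : 0 ≤ (2 * x) ^ (1 / α) := by positivity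
                                      linarith, ?_⟩
    have h1 : ((2 * x) ^ (1 / α)) ^ α = 2 * x := by
      rw [← Real.rpow_mul (by positivity), one_div_mul_cancel (by linarith), Real.rpow_one]
    have h2 : ((2 * x) ^ (1 / α)) ^ α ≤ ((2 * x) ^ (1 / α) + 1) ^ α := by
      apply Real.rpow_le_rpow (by positivity) (by linarith) (by linarith)
    linarith
  have hc0 : 0 < c := by linarith
  have hδ := (ml_kappa α hα1 hα2).2
  have hsh := ml_shift (fun s => cexp s * mlS α x s) c
    (Real.exp c * (4 / (1 + Real.cos (α * (Real.pi / 2))) * x ^ (-(1 / α + 1 / 2))))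
    (2 - α / 2) (by linarith) (by positivity) hc
    (fun s hs => differentiableAt_id.cexp.mul (ml_S_diff α x hα1 hα2 hx s (by linarith)))
    (fun s hs hs2 => by
      rw [norm_mul, mul_assoc (Real.exp c)]
      refine mul_le_mul ?_ (ml_S_bound α x hα1 hα2 hx s (by linarith)) (norm_nonneg _)
        (by positivity)
      rw [Complex.norm_exp]
      exact Real.exp_le_exp.2 hs2)
  rw [hsh]
  -- termwise
  set F : ℕ → ℝ → ℂ := fun k y => cexp ((c : ℂ) + y * I) *
    ((-(x : ℂ)) ^ k * (α * k + 2) * ((c : ℂ) + y * I) ^ (-((α * k + 3 : ℝ) : ℂ))) with hF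
  have hFe : ∀ k, F k = fun y : ℝ => ((-(x : ℂ)) ^ k * (α * k + 2)) *
      (cexp ((c : ℂ) + y * I) * ((c : ℂ) + y * I) ^ (-((α * k + 3 : ℝ) : ℂ))) := by
    intro k; ext y; simp only [hF]; ring
  have hz : ∀ k : ℕ, 1 < α * k + 3 := fun k => by
    have : 0 ≤ α * k := by positivity
    linarith
  have hFi : ∀ k, Integrable (F k) := by
    intro k
    rw [hFe]
    exact (ml_line_exp_intC _ (hz k) c hc).const_mul _
  have hFint : ∀ k, ∫ y, F k y = ((2 * Real.pi * ((-x) ^ k / Real.Gamma (α * k + 2)) : ℝ) : ℂ) := by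
    intro k
    rw [hFe, integral_const_mul, ml_hankel _ (hz k) c hc]
    have h2 : α * k + 2 ≠ 0 := by
      have : 0 ≤ α * k := by positivity
      linarith
    have hG : Real.Gamma (α * k + 3) = (α * k + 2) * Real.Gamma (α * k + 2) := by
      rw [← Real.Gamma_add_one h2]; ring_nf
    have hG2 : Real.Gamma (α * k + 2) ≠ 0 := (Real.Gamma_pos_of_pos (by
      have : 0 ≤ α * k := by positivity
      linarith)).ne'
    rw [hG]
    norm_cast
    push_cast
    have h2' : (α * k + 2 : ℂ) ≠ 0 := by exact_mod_cast h2
    have hG2' : (Real.Gamma (α * k + 2) : ℂ) ≠ 0 := by exact_mod_cast hG2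
    field_simp
  have hρ : x / c ^ α < 1 := (div_lt_one (by positivity)).2 hcx
  have hρ0 : 0 ≤ x / c ^ α := by positivity
  have hFs : Summable fun k => ∫ y, ‖F k y‖ := by
    have hs : Summable fun k : ℕ => (α * (k * (x / c ^ α) ^ k) + 2 * (x / c ^ α) ^ k) *
        (Real.exp c * ∫ y : ℝ, (1 + y ^ 2) ^ (-(3 : ℝ) / 2)) := by
      have hn : ‖x / c ^ α‖ < 1 := by rwa [Real.norm_of_nonneg hρ0]
      exact (((hasSum_coe_mul_geometric_of_norm_lt_one hn).summable.mul_left α).add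
        ((summable_geometric_of_norm_lt_one hn).mul_left 2)).mul_right _
    refine hs.of_nonneg_of_le (fun k => integral_nonneg fun y => norm_nonneg _) fun k => ?_
    rw [← integral_const_mul, ← integral_const_mul]
    refine integral_mono (hFi k).norm
      (((ml_line_int 3 (by norm_num)).const_mul _).const_mul _) fun y => ?_
    simp only [hF]
    have hcs : c ≤ ‖(c : ℂ) + y * I‖ := by
      have := Complex.abs_re_le_norm ((c : ℂ) + y * I)
      simp at this
      exact (le_abs_self c).trans this
    have hs0 : 0 < ‖(c : ℂ) + y * I‖ := by linarith
    have e : -((α * k + 3 : ℝ) : ℂ) = ((-(α * k + 3) : ℝ) : ℂ) := by push_cast; rfl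
    have e2 : ((α : ℂ) * k + 2) = ((α * k + 2 : ℝ) : ℂ) := by push_cast; rfl
    have hk : 0 ≤ α * k := by positivity
    rw [norm_mul, norm_mul, norm_mul, norm_pow, norm_neg, Complex.norm_real, e, e2,
      Complex.norm_real, Complex.norm_cpow_real, Complex.norm_exp, Real.norm_of_nonneg hx.le,
      Real.norm_of_nonneg (by linarith)]
    have h1 : ‖(c : ℂ) + y * I‖ ^ (-(α * k + 3)) ≤ ((c ^ α) ^ k)⁻¹ * (1 + y ^ 2) ^ (-(3 : ℝ) / 2) := by
      rw [neg_add, Real.rpow_add hs0]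
      refine mul_le_mul ?_ (ml_line_bound 3 (by norm_num) c hc y) (by positivity) (by positivity)
      rw [← Real.rpow_natCast, ← Real.rpow_mul hc0.le, ← Real.rpow_neg hc0.le]
      exact Real.rpow_le_rpow_of_nonpos hc0 hcs (by linarith)
    have h3 : ((c : ℂ) + y * I).re = c := by simp
    rw [h3]
    calc _ ≤ Real.exp c * (x ^ k * (α * k + 2) * (((c ^ α) ^ k)⁻¹ * (1 + y ^ 2) ^ (-(3 : ℝ) / 2))) := by
          gcongr
      _ = _ := by rw [div_pow]; ring
  have hsum := hasSum_integral_of_summable_integral_norm hFi hFs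
  have hpt : ∀ y : ℝ, ∑' k, F k y = cexp ((c : ℂ) + y * I) * mlS α x ((c : ℂ) + y * I)
      + (2 - α) / x * (cexp ((c : ℂ) + y * I) * ((c : ℂ) + y * I) ^ (-((3 - α : ℝ) : ℂ))) := by
    intro y
    have hcs : c ≤ ‖(c : ℂ) + y * I‖ := by
      have := Complex.abs_re_le_norm ((c : ℂ) + y * I)
      simp at this
      exact (le_abs_self c).trans this
    have hs0 : (c : ℂ) + y * I ≠ 0 := norm_pos_iff.1 (by linarith)
    have h := (ml_S_series α x hx ((c : ℂ) + y * I) hs0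
      (hcx.trans_le (Real.rpow_le_rpow hc0.le hcs (by linarith)))).mul_left (cexp ((c : ℂ) + y * I))
    rw [h.tsum_eq]
    ring
  have hSi : Integrable fun y : ℝ => cexp ((c : ℂ) + y * I) * mlS α x ((c : ℂ) + y * I) :=
    ml_line_f_int (fun s => cexp s * mlS α x s) c
      (Real.exp c * (4 / (1 + Real.cos (α * (Real.pi / 2))) * x ^ (-(1 / α + 1 / 2))))
      (2 - α / 2) (by linarith) (by positivity) hc
      (fun s hs => differentiableAt_id.cexp.mul (ml_S_diff α x hα1 hα2 hx s (by linarith)))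
      (fun s hs => by
        rw [norm_mul, mul_assoc (Real.exp c)]
        refine mul_le_mul ?_ (ml_S_bound α x hα1 hα2 hx s (by linarith)) (norm_nonneg _)
          (by positivity)
        rw [Complex.norm_exp]
        exact Real.exp_le_exp.2 hs.le)
  simp_rw [hpt, hFint] at hsum
  rw [integral_add hSi ((ml_line_exp_intC (3 - α) (by linarith) c hc).const_mul _),
    integral_const_mul, ml_hankel (3 - α) (by linarith) c hc] at hsum
  have h4 := hsum.tsum_eq
  rw [← Complex.ofReal_tsum, tsum_mul_left] at h4
  have h5 : ∑' k : ℕ, (-x) ^ k / Real.Gamma (α * k + 2) = mittagLeffler α 2 (-x) := rfl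
  rw [h5] at h4
  have hG : Real.Gamma (3 - α) = (2 - α) * Real.Gamma (2 - α) := by
    rw [← Real.Gamma_add_one (by linarith)]; ring_nf
  have hG2 : Real.Gamma (2 - α) ≠ 0 := (Real.Gamma_pos_of_pos (by linarith)).ne'
  have h6 : ((2 - α) / x * ((2 * Real.pi / Real.Gamma (3 - α) : ℝ) : ℂ) : ℂ)
      = ((2 * Real.pi * (1 / (x * Real.Gamma (2 - α))) : ℝ) : ℂ) := by
    rw [hG]
    have : 2 - α ≠ 0 := by linarith
    have e : ((2 - α) / x * ((2 * Real.pi / ((2 - α) * Real.Gamma (2 - α)) : ℝ) : ℂ) : ℂ)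
      = (((2 - α) / x * (2 * Real.pi / ((2 - α) * Real.Gamma (2 - α))) : ℝ) : ℂ) := by
      push_cast; rfl
    rw [e]
    congr 1
    field_simp
  rw [h6] at h4
  rw [mul_sub, Complex.ofReal_sub, h4]
  ring

lemma ml_asymp (α : ℝ) (hα1 : 1 < α) (hα2 : α < 2) : ∃ K : ℝ, ∀ x : ℝ, 0 < x →
    |mittagLeffler α 2 (-x) - 1 / (x * Real.Gamma (2 - α))| ≤ K * x ^ (-(1 / α + 1 / 2)) := by
  have hδ := (ml_kappa α hα1 hα2).2
  set A := 4 / (1 + Real.cos (α * (Real.pi / 2))) with hA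
  have hA0 : 0 < A := by positivity
  refine ⟨(2 * Real.pi)⁻¹ * (Real.exp 1 * A * ∫ y : ℝ, (1 + y ^ 2) ^ (-(2 - α / 2) / 2)), ?_⟩
  intro x hx
  have h := ml_rep α x hα1 hα2 hx
  have hb : ‖∫ y : ℝ, cexp ((1 : ℝ) + y * I) * mlS α x ((1 : ℝ) + y * I)‖
      ≤ ∫ y : ℝ, (Real.exp 1 * A * x ^ (-(1 / α + 1 / 2))) * (1 + y ^ 2) ^ (-(2 - α / 2) / 2) := by
    refine norm_integral_le_of_norm_le ((ml_line_int (2 - α / 2) (by linarith)).const_mul _) ?_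
    filter_upwards with y
    have h1 := ml_S_bound α x hα1 hα2 hx ((1 : ℝ) + y * I) (by simp)
    have h2 := ml_line_bound (2 - α / 2) (by linarith) 1 le_rfl y
    rw [norm_mul, Complex.norm_exp]
    have h3 : (((1 : ℝ) : ℂ) + y * I).re = 1 := by simp
    rw [h3, mul_assoc, mul_assoc]
    refine mul_le_mul_of_nonneg_left (h1.trans ?_) (by positivity)
    rw [← hA, mul_assoc]
    gcongr
  rw [← h, Complex.norm_real, Real.norm_eq_abs, abs_mul, abs_of_pos (by positivity),
    integral_const_mul] at hb
  have hpi := Real.pi_pos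
  rw [mul_assoc, inv_mul_eq_div, le_div_iff₀ (by positivity)]
  linarith

lemma ml_lower (α : ℝ) (hα1 : 1 < α) (hα2 : α < 2) : ∃ m x₀ : ℝ, 0 < m ∧ 0 < x₀ ∧
    ∀ x, x₀ ≤ x → m ≤ x * |mittagLeffler α 2 (-x)| := by
  obtain ⟨K, hK⟩ := ml_asymp α hα1 hα2
  have hG : 0 < Real.Gamma (2 - α) := Real.Gamma_pos_of_pos (by linarith)
  have hp : 0 < 1 / α - 1 / 2 := by
    rw [sub_pos]; exact one_div_lt_one_div_of_lt (by linarith) hα2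
  have ht : Tendsto (fun x : ℝ => K * x ^ (-(1 / α - 1 / 2))) atTop (𝓝 0) := by
    simpa using (tendsto_rpow_neg_atTop hp).const_mul K
  have ht' : Tendsto (fun x : ℝ => K * x ^ (1 - (1 / α + 1 / 2))) atTop (𝓝 0) := by
    have hq : 0 < 1 / α + 1 / 2 - 1 := by linarith
    have := (tendsto_rpow_neg_atTop hq).const_mul K
    simpa using this
  have hev := ht'.eventually (gt_mem_nhds (by positivity : 0 < 1 / (2 * Real.Gamma (2 - α))))
  obtain ⟨x₁, hx₁⟩ := eventually_atTop.1 hev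
  refine ⟨1 / (2 * Real.Gamma (2 - α)), max x₁ 1, by positivity, by positivity, fun x hx => ?_⟩
  have hx1 : 0 < x := by linarith [le_max_right x₁ 1]
  have h1 := hx₁ x ((le_max_left _ _).trans hx)
  have h2 := hK x hx1
  have h3 : x * (K * x ^ (-(1 / α + 1 / 2))) = K * x ^ (1 - (1 / α + 1 / 2)) := by
    rw [sub_eq_add_neg, Real.rpow_add hx1, Real.rpow_one]; ring
  have h4 : x * (1 / (x * Real.Gamma (2 - α))) = 2 * (1 / (2 * Real.Gamma (2 - α))) := by
    field_simp
  have h5 : 1 / (x * Real.Gamma (2 - α)) ≤ |mittagLeffler α 2 (-x)| +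
      K * x ^ (-(1 / α + 1 / 2)) := by
    linarith [neg_abs_le (mittagLeffler α 2 (-x) - 1 / (x * Real.Gamma (2 - α))),
      le_abs_self (mittagLeffler α 2 (-x))]
  have h6 := mul_le_mul_of_nonneg_left h5 hx1.le
  rw [h4, mul_add, h3] at h6
  linarith

end MLHelpers


/-- backward-stability estimate (Theorem 3.1, general `α ∈ (1,2)`)
in Fourier coefficients: for `T > 0` and a nondecreasing positive sequence `λ_n → ∞`
with `E_{α,2}(−λ_n T^α) ≠ 0` for all `n`, there is `C_T > 0` such that for every
sequence `a`, if `b_n = T E_{α,2}(−λ_n T^α) a_n` and `∑ λ_n^{2−2γ} b_n²` converges,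
then `∑ λ_n^{−2γ} a_n²` converges and is `≤ C_T ∑ λ_n^{2−2γ} b_n²`. -/
theorem backward_stability_general (α γ T : ℝ) (hα1 : 1 < α) (hα2 : α < 2) (hT : 0 < T)
    (lam : ℕ → ℝ) (hmono : Monotone lam) (hpos : ∀ n, 0 < lam n)
    (htend : Filter.Tendsto lam Filter.atTop Filter.atTop)
    (hne : ∀ n, mittagLeffler α 2 (-(lam n * T ^ α)) ≠ 0) :
    ∃ C : ℝ, 0 < C ∧ ∀ a : ℕ → ℝ,
      (Summable fun n =>
          lam n ^ (2 - 2 * γ) * (T * mittagLeffler α 2 (-(lam n * T ^ α)) * a n) ^ 2) →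
      Summable (fun n => lam n ^ (-(2 * γ)) * a n ^ 2) ∧
      (∑' n, lam n ^ (-(2 * γ)) * a n ^ 2) ≤
        C * ∑' n, lam n ^ (2 - 2 * γ) * (T * mittagLeffler α 2 (-(lam n * T ^ α)) * a n) ^ 2 := by
  obtain ⟨m₁, x₀, hm₁, hx₀, hlow⟩ := ml_lower α hα1 hα2
  have hTα : 0 < T ^ α := Real.rpow_pos_of_pos hT α
  obtain ⟨m, hm, hmn⟩ : ∃ m : ℝ, 0 < m ∧
      ∀ n, m ≤ lam n * |mittagLeffler α 2 (-(lam n * T ^ α))| := by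
    obtain ⟨N, hN⟩ := Filter.eventually_atTop.1 (htend.eventually_ge_atTop (x₀ / T ^ α))
    have hfin : ∃ m₂ : ℝ, 0 < m₂ ∧
        ∀ n < N, m₂ ≤ lam n * |mittagLeffler α 2 (-(lam n * T ^ α))| := by
      clear hN
      induction N with
      | zero => exact ⟨1, one_pos, by simp⟩
      | succ N ih =>
        obtain ⟨m₂, h0, h⟩ := ih
        have hp : 0 < lam N * |mittagLeffler α 2 (-(lam N * T ^ α))| :=
          mul_pos (hpos N) (abs_pos.2 (hne N))
        refine ⟨min m₂ (lam N * |mittagLeffler α 2 (-(lam N * T ^ α))|), lt_min h0 hp, ?_⟩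
        intro n hn
        rcases Nat.lt_succ_iff_lt_or_eq.1 hn with h1 | h1
        · exact (min_le_left _ _).trans (h n h1)
        · subst h1; exact min_le_right _ _
    obtain ⟨m₂, h0, h⟩ := hfin
    refine ⟨min m₂ (m₁ / T ^ α), lt_min h0 (by positivity), fun n => ?_⟩
    rcases lt_or_ge n N with h1 | h1
    · exact (min_le_left _ _).trans (h n h1)
    · refine (min_le_right _ _).trans ?_
      have h2 := hN n h1
      rw [div_le_iff₀ hTα] at h2
      have h3 := hlow _ h2
      rw [div_le_iff₀ hTα]
      linarith
  have hkey : ∀ (a : ℕ → ℝ) (n : ℕ), lam n ^ (-(2 * γ)) * a n ^ 2 ≤ 1 / (T ^ 2 * m ^ 2) *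
      (lam n ^ (2 - 2 * γ) * (T * mittagLeffler α 2 (-(lam n * T ^ α)) * a n) ^ 2) := by
    intro a n
    have hl := hpos n
    have e : lam n ^ (2 - 2 * γ) = lam n ^ (-(2 * γ)) * lam n ^ 2 := by
      rw [← Real.rpow_two, ← Real.rpow_add hl]; ring_nf
    have h2 : m ^ 2 ≤ (lam n * |mittagLeffler α 2 (-(lam n * T ^ α))|) ^ 2 := by
      have := hmn n
      gcongr
    rw [mul_pow, sq_abs] at h2
    have hP : 0 < lam n ^ (-(2 * γ)) := Real.rpow_pos_of_pos hl _
    rw [e, one_div, inv_mul_eq_div, le_div_iff₀ (by positivity)]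
    have h3 : 0 ≤ lam n ^ (-(2 * γ)) * a n ^ 2 * T ^ 2 := by positivity
    have h4 := mul_le_mul_of_nonneg_left h2 h3
    linarith
  refine ⟨1 / (T ^ 2 * m ^ 2), by positivity, fun a hs => ?_⟩
  have hs2 := hs.mul_left (1 / (T ^ 2 * m ^ 2))
  have hs1 : Summable (fun n => lam n ^ (-(2 * γ)) * a n ^ 2) :=
    hs2.of_nonneg_of_le
      (fun n => mul_nonneg (Real.rpow_nonneg (hpos n).le _) (sq_nonneg _)) (hkey a)
  refine ⟨hs1, ?_⟩
  rw [← tsum_mul_left]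
  exact hs1.tsum_le_tsum (hkey a) hs2
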